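/- For every k ∈ ℤ, every r ∈ {1,…,n} and every q ∈ U_n: V_r^{(k)} = Σ_{j=0}^{r−1} q_j·V_1^{(k+r−1−j)}, i.e. V_r^{(k)} = q_{r−1}·V_1^{(k)} + q_{r−2}·V_1^{(k+1)} + … + q_1·V_1^{(k+r−2)} + V_1^{(k+r−1)}, with the convention q_0 = 1. -/

import Mathlib

open scoped BigOperators

/-- Coordinate of `q` with the conventions `q₀ = 1` and `q_α = 0` for `α < 0` or `α > n`
(1-based indexing by an integer). -/
def qc (n : ℕ) (q : Fin n → ℝ) (r : ℤ) : ℝ :=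
  if r = 0 then 1
  else if h : 1 ≤ r ∧ r ≤ (n : ℤ) then q ⟨(r - 1).toNat, by omega⟩ else 0

/-- The Benenti potentials `V_r^{(k)}` in `n` variables. -/
noncomputable def benenti (n : ℕ) (r k : ℤ) (q : Fin n → ℝ) : ℝ :=
  if r < 1 ∨ (n : ℤ) < r then 0
  else if k = 0 then (if r = (n : ℤ) then 1 else 0)
  else if 0 < k then
    benenti n (r + 1) (k - 1) q - qc n q r * benenti n 1 (k - 1) q
  else
    benenti n (r - 1) (k + 1) q - (qc n q (r - 1) / qc n q n) * benenti n n (k + 1) q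
termination_by k.natAbs
decreasing_by all_goals omega

/-- Partial derivative of `f` with respect to the `i`-th coordinate at `q`. -/
noncomputable def pd {n : ℕ} (f : (Fin n → ℝ) → ℝ) (i : Fin n) (q : Fin n → ℝ) : ℝ :=
  deriv (fun t => f (Function.update q i t)) (q i)

/-- Euler–Lagrange expression `E_l(L)[c](x)` of a Lagrangian density `L(q,p)`
along a curve `c`. -/
noncomputable def elExpr {n : ℕ} (L : (Fin n → ℝ) → (Fin n → ℝ) → ℝ) (l : Fin n)
    (c : ℝ → Fin n → ℝ) (x : ℝ) : ℝ :=
  pd (fun vq => L vq (deriv c x)) l (c x)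
    - deriv (fun y => pd (fun vp => L (c y) vp) l (deriv c y)) x

/-- The Lagrangian density `L^{n,m,k}`. -/
noncomputable def lag (n : ℕ) (m k : ℤ) (q p : Fin n → ℝ) : ℝ :=
  (1 / 2) * ∑ i : Fin n, ∑ j : Fin n,
      benenti n 1 (2 * (n : ℤ) - m - ((i : ℕ) + 1) - ((j : ℕ) + 1)) q * p i * p j
    - benenti n 1 k q

/-- The matrix `L` of the Benenti class in Viète coordinates. -/
def Lmat (n : ℕ) (q : Fin n → ℝ) : Matrix (Fin n) (Fin n) ℝ :=
  Matrix.of fun i j => if (j : ℕ) = 0 then -q i else if (j : ℕ) = (i : ℕ) + 1 then 1 else 0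

theorem benenti_out (n : ℕ) (r k : ℤ) (q : Fin n → ℝ) (h : r < 1 ∨ (n : ℤ) < r) :
    benenti n r k q = 0 := by
  rw [benenti, if_pos h]

theorem benenti_neg (n : ℕ) (r k : ℤ) (q : Fin n → ℝ) (h1 : 1 ≤ r) (h2 : r ≤ n) (hk : k < 0) :
    benenti n r k q = benenti n (r - 1) (k + 1) q
      - (qc n q (r - 1) / qc n q n) * benenti n n (k + 1) q := by
  rw [benenti, if_neg (by omega), if_neg (by omega), if_neg (by omega)]

theorem benenti_pos (n : ℕ) (r k : ℤ) (q : Fin n → ℝ) (h1 : 1 ≤ r) (h2 : r ≤ n) (hk : 0 < k) :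
    benenti n r k q = benenti n (r + 1) (k - 1) q - qc n q r * benenti n 1 (k - 1) q := by
  rw [benenti, if_neg (by omega), if_neg (by omega), if_pos hk]

theorem benenti_up (n : ℕ) (r k : ℤ) (q : Fin n → ℝ) (h1 : 1 ≤ r) (h2 : r ≤ n)
    (hq : qc n q n ≠ 0) :
    benenti n (r + 1) k q = benenti n r (k + 1) q + qc n q r * benenti n 1 k q := by
  by_cases hk : 0 ≤ k
  · have h := benenti_pos n r (k + 1) q h1 h2 (by omega)
    rw [add_sub_cancel_right] at h
    rw [h]; ring
  · have e1 := benenti_neg n 1 k q le_rfl (by omega) (by omega)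
    have q0 : qc n q (1 - 1) = 1 := by simp [qc]
    rw [benenti_out n (1 - 1) _ q (by omega), q0] at e1
    rcases eq_or_lt_of_le h2 with h | h
    · subst h
      rw [benenti_out n _ _ q (by omega), e1]
      field_simp
      ring
    · have e2 := benenti_neg n (r + 1) k q (by omega) (by omega) (by omega)
      rw [add_sub_cancel_right] at e2
      rw [e2, e1]
      ring

/-- for every `k ∈ ℤ`, `r ∈ {1,…,n}` and `q ∈ U_n`:
`V_r^{(k)} = Σ_{j=0}^{r−1} q_j·V₁^{(k+r−1−j)}` (with `q₀ = 1`). -/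
theorem benenti_upward_expansion
    (n : ℕ) (hn : 1 ≤ n) (k : ℤ) (r : ℕ) (hr1 : 1 ≤ r) (hr2 : r ≤ n)
    (q : Fin n → ℝ) (hq : q ⟨n - 1, by omega⟩ ≠ 0) :
    benenti n r k q
      = ∑ j ∈ Finset.range r,
          qc n q (j : ℤ) * benenti n 1 (k + (r : ℤ) - 1 - j) q := by
  have hq' : qc n q n ≠ 0 := by
    have e : qc n q n = q ⟨n - 1, by omega⟩ := by
      unfold qc
      rw [if_neg (by omega), dif_pos (by omega)]
      congr 2
      omega
    rw [e]; exact hq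
  clear hq
  induction r, hr1 using Nat.le_induction generalizing k with
  | base => simp [qc]
  | succ r hr ih =>
    rw [Finset.sum_range_succ]
    push_cast
    rw [benenti_up n r k q (by omega) (by omega) hq', ih (k + 1) (by omega)]
    congr 1
    · apply Finset.sum_congr rfl
      intro j _
      congr 2
      ring
    · congr 2
      ring
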